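/- Let M be a Lie ideal of L of codimension one such that ⁅L, Z(M)⁆ ≠ 0, where Z(M) is the center of M (this is the situation L = M ⊕ k·d for a derivation d of M with d(Z(M)) ≠ 0). Then: (i) i(M) = i(L) + 1; (ii) L has a CP if and only if M has a CP; (iii) if L is square integrable then so is M. -/

import Mathlib

open Module

noncomputable section

variable (k : Type*) [Field k]

/-- `L(f) = {x ∈ L | f ⁅x, y⁆ = 0 for all y ∈ L}`. -/
def lieStab (L : Type*) [LieRing L] [LieAlgebra k L] (f : Module.Dual k L) :
    Submodule k L where
  carrier := {x | ∀ y : L, f ⁅x, y⁆ = 0}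
  add_mem' := fun {a b} ha hb y => by rw [add_lie, map_add, ha y, hb y, add_zero]
  zero_mem' := fun y => by rw [zero_lie, map_zero]
  smul_mem' := fun c a ha y => by rw [smul_lie, map_smul, ha y, smul_zero]

/-- The index `i(L)`, the minimum of `dim L(f)` over all `f ∈ L*`. -/
def lieIndex (L : Type*) [LieRing L] [LieAlgebra k L] : ℕ :=
  ⨅ f : Module.Dual k L, finrank k (lieStab k L f)

/-- `f ∈ L*` is regular if `dim L(f) = i(L)`. -/
def LieIsRegular (L : Type*) [LieRing L] [LieAlgebra k L] (f : Module.Dual k L) : Prop :=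
  finrank k (lieStab k L f) = lieIndex k L

/-- A commutative polarization of `L`: an abelian Lie subalgebra `P` with
`2 dim P = dim L + i(L)`. -/
def IsCP (L : Type*) [LieRing L] [LieAlgebra k L] (P : LieSubalgebra k L) : Prop :=
  IsLieAbelian ↥P ∧ 2 * finrank k ↥P = finrank k L + lieIndex k L

/-- A CP-ideal of `L`: a CP which is also a Lie ideal of `L`. -/
def IsCPIdeal (L : Type*) [LieRing L] [LieAlgebra k L] (P : LieSubalgebra k L) : Prop :=
  IsCP k L P ∧ ∀ x y : L, y ∈ P → ⁅x, y⁆ ∈ P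

/-- `L` is square integrable if `i(L) = dim Z(L)`. -/
def SquareIntegrable (L : Type*) [LieRing L] [LieAlgebra k L] : Prop :=
  lieIndex k L = finrank k ↥(LieAlgebra.center k L)


/-- Along a line of linear maps through `A`, some point other than `A` has kernel no larger
than that of `A`. -/
theorem exists_ne_zero_finrank_ker_add_smul_le {k V W : Type*} [Field k] [Infinite k]
    [AddCommGroup V] [Module k V] [FiniteDimensional k V] [AddCommGroup W] [Module k W]
    (A B : V →ₗ[k] W) :
    ∃ t : k, t ≠ 0 ∧
      finrank k (LinearMap.ker (A + t • B)) ≤ finrank k (LinearMap.ker A) := by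
  obtain ⟨S, hS⟩ := (LinearMap.ker A).exists_isCompl
  have hinj : LinearMap.ker (A ∘ₗ S.subtype) = ⊥ := by
    rw [LinearMap.ker_eq_bot']
    intro x hx
    have : (x : V) ∈ LinearMap.ker A ⊓ S := ⟨hx, x.2⟩
    rw [hS.inf_eq_bot, Submodule.mem_bot] at this
    exact Subtype.ext this
  obtain ⟨ψ, hψ⟩ := LinearMap.exists_leftInverse_of_injective _ hinj
  have hfin : {μ | Module.End.HasEigenvalue (ψ ∘ₗ B ∘ₗ S.subtype) μ}.Finite :=
    Module.End.finite_hasEigenvalue _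
  obtain ⟨s, hs⟩ := (hfin.union (Set.finite_singleton 0)).exists_notMem
  simp only [Set.mem_union, Set.mem_ofPred_eq, Set.mem_singleton_iff, not_or] at hs
  obtain ⟨hs, hs0⟩ := hs
  refine ⟨-s⁻¹, by simpa using hs0, ?_⟩
  have hdisj : Disjoint (LinearMap.ker (A + (-s⁻¹) • B)) S := by
    rw [Submodule.disjoint_def]
    intro x hx hxS
    by_contra hx0
    refine hs (Module.End.hasEigenvalue_of_hasEigenvector
      (x := (⟨x, hxS⟩ : S)) ⟨Module.End.mem_eigenspace_iff.2 ?_, fun h => hx0 ?_⟩)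
    · have h1 : ψ (A x) = ⟨x, hxS⟩ := LinearMap.congr_fun hψ ⟨x, hxS⟩
      have h2 : A x = s⁻¹ • B x := by
        rw [LinearMap.mem_ker, LinearMap.add_apply, LinearMap.smul_apply, neg_smul] at hx
        exact add_neg_eq_zero.1 hx
      have h3 : B x = s • A x := by rw [h2, smul_inv_smul₀ hs0]
      change ψ (B x) = _
      rw [h3, map_smul, h1]
    · exact congrArg Subtype.val h
  have h1 := Submodule.finrank_add_finrank_le_of_disjoint hdisj
  have h2 := Submodule.finrank_add_eq_of_isCompl hS
  omega

/-- A functional not vanishing on a subspace cuts its dimension by one. -/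
theorem finrank_inf_ker_add_one {k V : Type*} [Field k] [AddCommGroup V] [Module k V]
    [FiniteDimensional k V] (S : Submodule k V) (φ : Module.Dual k V) {v : V} (hv : v ∈ S)
    (hφ : φ v ≠ 0) : finrank k ↥(S ⊓ LinearMap.ker φ) + 1 = finrank k S := by
  have h := LinearMap.finrank_range_add_finrank_ker (φ ∘ₗ S.subtype)
  have hsurj : LinearMap.range (φ ∘ₗ S.subtype) = ⊤ :=
    LinearMap.range_eq_top.2 (LinearMap.surjective fun h0 =>
      hφ (LinearMap.congr_fun h0 ⟨v, hv⟩))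
  have hker : (LinearMap.ker (φ ∘ₗ S.subtype)).map S.subtype = S ⊓ LinearMap.ker φ := by
    rw [LinearMap.ker_comp, Submodule.map_comap_subtype]
  rw [hsurj, finrank_top, finrank_self, ← Submodule.finrank_map_subtype_eq, hker] at h
  omega

theorem lieIndex_le {k : Type*} [Field k] (L : Type*) [LieRing L] [LieAlgebra k L]
    (f : Module.Dual k L) : lieIndex k L ≤ finrank k (lieStab k L f) :=
  ciInf_le (OrderBot.bddBelow _) f

theorem exists_lieIsRegular (k : Type*) [Field k] (L : Type*) [LieRing L] [LieAlgebra k L] :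
    ∃ f : Module.Dual k L, LieIsRegular k L f :=
  ciInf_mem (fun f : Module.Dual k L => finrank k (lieStab k L f))

/-- The subalgebra `L(f)` is the kernel of the alternating form `(x, y) ↦ f ⁅x, y⁆`. -/
theorem lieStab_eq_ker {k L : Type*} [Field k] [LieRing L] [LieAlgebra k L]
    (f : Module.Dual k L) :
    lieStab k L f =
      LinearMap.ker ((LieModule.toEnd k L L : L →ₗ[k] Module.End k L).compr₂ f) := by
  ext x
  rw [LinearMap.mem_ker, LinearMap.ext_iff]
  rfl

/-- A regular functional can be chosen to be nonzero at a given nonzero vector. -/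
theorem exists_lieIsRegular_apply_ne_zero {k L : Type*} [Field k] [Infinite k]
    [LieRing L] [LieAlgebra k L] [FiniteDimensional k L] {u : L} (hu : u ≠ 0) :
    ∃ f : Module.Dual k L, LieIsRegular k L f ∧ f u ≠ 0 := by
  obtain ⟨f, hf⟩ := exists_lieIsRegular k L
  by_cases hfu : f u = 0
  · obtain ⟨h, hh⟩ : ∃ h : Module.Dual k L, h u ≠ 0 := by
      by_contra! hc
      exact hu ((Module.forall_dual_apply_eq_zero_iff k u).1 hc)
    obtain ⟨t, ht, hle⟩ := exists_ne_zero_finrank_ker_add_smul_le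
      ((LieModule.toEnd k L L : L →ₗ[k] Module.End k L).compr₂ f)
      ((LieModule.toEnd k L L : L →ₗ[k] Module.End k L).compr₂ h)
    have heq : (LieModule.toEnd k L L : L →ₗ[k] Module.End k L).compr₂ f +
        t • (LieModule.toEnd k L L : L →ₗ[k] Module.End k L).compr₂ h =
        (LieModule.toEnd k L L : L →ₗ[k] Module.End k L).compr₂ (f + t • h) := rfl
    rw [heq, ← lieStab_eq_ker, ← lieStab_eq_ker] at hle
    refine ⟨f + t • h, le_antisymm (hle.trans hf.le) (lieIndex_le L _), ?_⟩
    simpa [hfu] using ⟨ht, hh⟩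
  · exact ⟨f, hf, hfu⟩

/-- The centre is contained in every `L(f)`. -/
theorem finrank_center_le_lieIndex (k L : Type*) [Field k] [LieRing L] [LieAlgebra k L]
    [FiniteDimensional k L] : finrank k ↥(LieAlgebra.center k L) ≤ lieIndex k L := by
  obtain ⟨f, hf⟩ := exists_lieIsRegular k L
  rw [← hf]
  refine Submodule.finrank_mono (s := (LieAlgebra.center k L).toSubmodule) fun x hx y => ?_
  rw [← lie_skew, (LieModule.mem_maxTrivSubmodule k L L x).1 hx y, neg_zero, map_zero]

/-- A subspace of codimension one is the kernel of a functional. -/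
theorem exists_dual_ker_eq {k V : Type*} [Field k] [AddCommGroup V] [Module k V]
    [FiniteDimensional k V] (S : Submodule k V) (hS : finrank k S + 1 = finrank k V) :
    ∃ φ : Module.Dual k V, LinearMap.ker φ = S := by
  have hne : S ≠ ⊤ := by
    rintro rfl
    rw [finrank_top] at hS
    omega
  obtain ⟨x, -, hx⟩ := SetLike.exists_of_lt hne.lt_top
  obtain ⟨φ, hφx, hφ⟩ := Submodule.exists_le_ker_of_notMem hx
  refine ⟨φ, (Submodule.eq_of_le_of_finrank_eq hφ ?_).symm⟩
  have h := finrank_inf_ker_add_one ⊤ φ (Submodule.mem_top (x := x)) hφx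
  rw [top_inf_eq, finrank_top] at h
  omega

section CodimensionOne

variable {k L : Type*} [Field k] [LieRing L] [LieAlgebra k L]

/-- An element commuting with a codimension-one subalgebra but not central is moved by every
element outside the subalgebra. -/
theorem lie_ne_zero_of_notMem (M : LieSubalgebra k L) {φ : Module.Dual k L}
    (hφ : LinearMap.ker φ = M.toSubmodule) {x₀ z : L} (hz : ∀ y ∈ M, ⁅y, z⁆ = 0)
    (hxz : ⁅x₀, z⁆ ≠ 0) {x : L} (hx : x ∉ M) : ⁅x, z⁆ ≠ 0 := by
  have hmem : ∀ y, φ y = 0 ↔ y ∈ M := fun y => by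
    rw [← LinearMap.mem_ker, hφ, LieSubalgebra.mem_toSubmodule]
  intro h
  have hy := hz (φ x₀ • x - φ x • x₀) ((hmem _).1 (by simp [mul_comm]))
  rw [sub_lie, smul_lie, smul_lie, h, smul_zero, zero_sub, neg_eq_zero, smul_eq_zero] at hy
  exact hy.elim (fun h' => hx ((hmem x).1 h')) hxz

/-- If `z` is central in the codimension-one subalgebra `M` and `f ⁅x₀, z⁆ ≠ 0`, then `L(f)` is a
hyperplane in `M(f|M)`. -/
theorem finrank_lieStab_add_one [FiniteDimensional k L] (M : LieSubalgebra k L)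
    {φ : Module.Dual k L} (hφ : LinearMap.ker φ = M.toSubmodule) {x₀ z : L} (hzM : z ∈ M)
    (hz : ∀ y ∈ M, ⁅y, z⁆ = 0) (f : Module.Dual k L) (hf : f ⁅x₀, z⁆ ≠ 0) :
    finrank k (lieStab k L f) + 1 =
      finrank k (lieStab k M (f ∘ₗ M.toSubmodule.subtype)) := by
  have hmem : ∀ y, φ y = 0 ↔ y ∈ M := fun y => by
    rw [← LinearMap.mem_ker, hφ, LieSubalgebra.mem_toSubmodule]
  have hφx₀ : φ x₀ ≠ 0 := fun h => hf (by rw [hz x₀ ((hmem _).1 h), map_zero])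
  set S := (lieStab k M (f ∘ₗ M.toSubmodule.subtype)).map M.toSubmodule.subtype with hS
  have hzS : z ∈ S := by
    refine ⟨⟨z, hzM⟩, fun y => ?_, rfl⟩
    change f ⁅z, (y : L)⁆ = 0
    rw [← lie_skew, hz y y.2, neg_zero, map_zero]
  let ψ : Module.Dual k L := f ∘ₗ (LieModule.toEnd k L L x₀)
  have hdec : lieStab k L f = S ⊓ LinearMap.ker ψ := by
    ext x
    constructor
    · intro hx
      have hxM : x ∈ M := by
        by_contra hxM
        have hy := hz (φ x₀ • x - φ x • x₀) ((hmem _).1 (by simp [mul_comm]))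
        rw [sub_lie, smul_lie, smul_lie] at hy
        have := congrArg f hy
        rw [map_sub, map_smul, map_smul, hx z, smul_zero, zero_sub, map_zero, neg_eq_zero,
          smul_eq_zero] at this
        exact this.elim (fun h' => hxM ((hmem x).1 h')) hf
      refine ⟨⟨⟨x, hxM⟩, fun y => hx y, rfl⟩, ?_⟩
      change f ⁅x₀, x⁆ = 0
      rw [← lie_skew, map_neg, hx x₀, neg_zero]
    · rintro ⟨⟨x, hx, rfl⟩, hψ⟩ y
      replace hψ : f ⁅x₀, (x : L)⁆ = 0 := hψ
      have hy := hx ⟨φ x₀ • y - φ y • x₀, (hmem _).1 (by simp [mul_comm])⟩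
      change f ⁅(x : L), φ x₀ • y - φ y • x₀⁆ = 0 at hy
      change f ⁅(x : L), y⁆ = 0
      rw [lie_sub, lie_smul, lie_smul, ← lie_skew (x : L) x₀, map_sub, map_smul, map_smul, map_neg,
        hψ, neg_zero, smul_zero, sub_zero, smul_eq_zero] at hy
      exact hy.resolve_left hφx₀
  have h := finrank_inf_ker_add_one S ψ hzS hf
  rw [← hdec] at h
  rw [h, hS]
  exact Submodule.finrank_map_subtype_eq _ _

theorem lieIndex_eq_add_one [Infinite k] [FiniteDimensional k L] (M : LieSubalgebra k L)
    {φ : Module.Dual k L} (hφ : LinearMap.ker φ = M.toSubmodule) {x₀ z : L} (hzM : z ∈ M)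
    (hz : ∀ y ∈ M, ⁅y, z⁆ = 0) (hxz : ⁅x₀, z⁆ ≠ 0) (hxzM : ⁅x₀, z⁆ ∈ M) :
    lieIndex k M = lieIndex k L + 1 := by
  apply le_antisymm
  · obtain ⟨f, hf, hfu⟩ := exists_lieIsRegular_apply_ne_zero (k := k) hxz
    rw [← hf, finrank_lieStab_add_one M hφ hzM hz f hfu]
    exact lieIndex_le _ _
  · obtain ⟨g, hg, hgu⟩ := exists_lieIsRegular_apply_ne_zero (k := k) (L := M)
      (u := ⟨⁅x₀, z⁆, hxzM⟩) fun h => hxz (congrArg Subtype.val h)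
    obtain ⟨f, rfl⟩ : ∃ f : Module.Dual k L, f ∘ₗ M.toSubmodule.subtype = g :=
      LinearMap.exists_extend (p := M.toSubmodule) g
    rw [← hg, ← finrank_lieStab_add_one M hφ hzM hz f hgu]
    exact Nat.add_le_add_right (lieIndex_le L f) 1

end CodimensionOne

theorem isLieAbelian_iff_forall_mem {k L : Type*} [Field k] [LieRing L] [LieAlgebra k L]
    (P : LieSubalgebra k L) : IsLieAbelian P ↔ ∀ x ∈ P, ∀ y ∈ P, ⁅x, y⁆ = 0 := by
  constructor
  · intro h x hx y hy
    exact congrArg Subtype.val (trivial_lie_zero P P ⟨x, hx⟩ ⟨y, hy⟩)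
  · exact fun h => ⟨fun x y => Subtype.ext (h x x.2 y y.2)⟩

/-- A pairwise commuting subspace contained in `M` gives an abelian subalgebra of `M`. -/
theorem exists_abelian_subalgebra {k L : Type*} [Field k] [LieRing L] [LieAlgebra k L]
    (M : LieSubalgebra k L) (S : Submodule k L) (hSM : S ≤ M.toSubmodule)
    (hS : ∀ x ∈ S, ∀ y ∈ S, ⁅x, y⁆ = 0) :
    ∃ Q : LieSubalgebra k M, IsLieAbelian Q ∧ finrank k Q = finrank k S := by
  refine ⟨{ S.comap M.toSubmodule.subtype with
    lie_mem' := fun {x y} hx hy => ?_ }, ?_, ?_⟩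
  · have h : ⁅x, y⁆ = 0 := Subtype.ext (hS x hx y hy)
    rw [h]
    exact Submodule.zero_mem _
  · rw [isLieAbelian_iff_forall_mem]
    exact fun x hx y hy => Subtype.ext (hS x hx y hy)
  · exact (Submodule.comapSubtypeEquivOfLe hSM).finrank_eq

/-- **Proposition 7.1.** Let `M` be a codimension-one Lie ideal of `L` with
`⁅L, Z(M)⁆ ≠ 0` (the situation `L = M ⊕ k d` for a derivation `d` of `M` with
`d(Z(M)) ≠ 0`).  Then (i) `i(M) = i(L) + 1`; (ii) `L` has a CP iff `M` has a CP;
(iii) if `L` is square integrable then so is `M`. -/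
theorem extension_by_derivation {k L : Type*} [Field k] [CharZero k]
    [LieRing L] [LieAlgebra k L] [FiniteDimensional k L] (M : LieSubalgebra k L)
    (hMideal : ∀ x y : L, y ∈ M → ⁅x, y⁆ ∈ M)
    (hcodim : finrank k ↥M + 1 = finrank k L)
    (hZ : ∃ (x : L) (z : ↥M), z ∈ LieAlgebra.center k ↥M ∧ ⁅x, (z : L)⁆ ≠ 0) :
    lieIndex k ↥M = lieIndex k L + 1 ∧
    ((∃ P : LieSubalgebra k L, IsCP k L P) ↔ (∃ Q : LieSubalgebra k ↥M, IsCP k ↥M Q)) ∧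
    (SquareIntegrable k L → SquareIntegrable k ↥M) := by
  obtain ⟨x₀, ⟨z, hzM⟩, hzc, hxz⟩ := hZ
  replace hxz : ⁅x₀, z⁆ ≠ 0 := hxz
  have hz : ∀ y ∈ M, ⁅y, z⁆ = 0 := fun y hy =>
    congrArg Subtype.val ((LieModule.mem_maxTrivSubmodule k M M _).1 hzc ⟨y, hy⟩)
  obtain ⟨φ, hφ⟩ := exists_dual_ker_eq M.toSubmodule hcodim
  have hindex := lieIndex_eq_add_one M hφ hzM hz hxz (hMideal x₀ z hzM)
  refine ⟨hindex, ⟨?_, ?_⟩, ?_⟩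
  · rintro ⟨P, hPab, hPdim⟩
    rw [isLieAbelian_iff_forall_mem] at hPab
    suffices h : ∃ S : Submodule k L, S ≤ M.toSubmodule ∧ (∀ x ∈ S, ∀ y ∈ S, ⁅x, y⁆ = 0) ∧
        finrank k S = finrank k P by
      obtain ⟨S, hSM, hS, hdim⟩ := h
      obtain ⟨Q, hQ, hQdim⟩ := exists_abelian_subalgebra M S hSM hS
      exact ⟨Q, hQ, by omega⟩
    by_cases hPM : P ≤ M
    · exact ⟨P.toSubmodule, hPM, hPab, rfl⟩
    obtain ⟨p, hp, hpM⟩ := SetLike.not_le_iff_exists.1 hPM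
    have hzP : z ∉ P := fun h => lie_ne_zero_of_notMem M hφ hz hxz hpM (hPab p hp z h)
    have hz' : ∀ y ∈ M, ⁅z, y⁆ = 0 := fun y hy => by rw [← lie_skew, hz y hy, neg_zero]
    refine ⟨(P.toSubmodule ⊓ M.toSubmodule) ⊔ Submodule.span k {z}, ?_, ?_, ?_⟩
    · exact sup_le inf_le_right ((Submodule.span_singleton_le_iff_mem _ _).2 hzM)
    · intro x hx y hy
      obtain ⟨a, ha, _, hc, rfl⟩ := Submodule.mem_sup.1 hx
      obtain ⟨b, hb, _, hd, rfl⟩ := Submodule.mem_sup.1 hy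
      obtain ⟨c, rfl⟩ := Submodule.mem_span_singleton.1 hc
      obtain ⟨d, rfl⟩ := Submodule.mem_span_singleton.1 hd
      simp [hPab a ha.1 b hb.1, hz a ha.2, hz' b hb.2]
    · have hφp : φ p ≠ 0 := fun h => hpM (by
        rwa [← LieSubalgebra.mem_toSubmodule, ← hφ, LinearMap.mem_ker])
      have h1 := finrank_inf_ker_add_one P.toSubmodule φ hp hφp
      rw [hφ] at h1
      have h2 : finrank k ↥((P.toSubmodule ⊓ M.toSubmodule) ⊔ Submodule.span k {z}) =
          finrank k ↥(P.toSubmodule ⊓ M.toSubmodule) + 1 :=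
        Submodule.finrank_sup_span_singleton fun h => hzP h.1
      exact h2.trans h1
  · rintro ⟨Q, hQab, hQdim⟩
    rw [isLieAbelian_iff_forall_mem] at hQab
    refine ⟨Q.map M.incl, ?_, ?_⟩
    · rw [isLieAbelian_iff_forall_mem]
      rintro _ ⟨x, hx, rfl⟩ _ ⟨y, hy, rfl⟩
      exact congrArg Subtype.val (hQab x hx y hy)
    · have h : finrank k ↥(Q.map M.incl) = finrank k Q :=
        Submodule.finrank_map_subtype_eq M.toSubmodule Q.toSubmodule
      omega
  · intro hL
    refine le_antisymm ?_ (finrank_center_le_lieIndex k M)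
    rw [hindex, hL]
    have hcl : (LieAlgebra.center k L).toSubmodule <
        (LieAlgebra.center k M).toSubmodule.map M.toSubmodule.subtype := by
      refine SetLike.lt_iff_le_and_exists.2 ⟨fun x hx => ?_, z,
        Submodule.mem_map.2 ⟨_, hzc, rfl⟩, fun h => hxz ?_⟩
      · have hx' := (LieModule.mem_maxTrivSubmodule k L L x).1 hx
        have hxM : x ∈ M := by
          by_contra hxM
          exact lie_ne_zero_of_notMem M hφ hz hxz hxM (by rw [← lie_skew, hx' z, neg_zero])
        exact ⟨⟨x, hxM⟩, (LieModule.mem_maxTrivSubmodule k M M _).2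
          fun y => Subtype.ext (hx' y), rfl⟩
      · exact (LieModule.mem_maxTrivSubmodule k L L z).1 h x₀
    have h := Submodule.finrank_lt_finrank_of_lt hcl
    rw [Submodule.finrank_map_subtype_eq] at h
    exact h

end
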